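/- The single-piece decomposition preserves termination of the oblivious and semi-oblivious chase: for X ∈ {O, SO}, if a rule set 𝓡 is in CT_X^∀ then sp(𝓡) is in CT_X^∀. -/

import Mathlib

namespace ExRules

open scoped Classical

noncomputable section

/-- Terms: constants or variables, each indexed by a natural number. -/
inductive Term where
  | const : ℕ → Term
  | var : ℕ → Term
deriving DecidableEq

/-- An atom: a predicate symbol applied to a list of terms (the arity of the
predicate is the length of the argument list). -/
structure Atom where
  pred : ℕ
  args : List Term
deriving DecidableEq

/-- A factbase is a finite set of atoms. -/
abbrev FactBase := Finset Atom

/-- A substitution: a map on variables (extended by the identity on constants). -/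
abbrev Subst := ℕ → Term

def applyTerm (σ : Subst) : Term → Term
  | .const c => .const c
  | .var v => σ v

def Atom.subst (σ : Subst) (a : Atom) : Atom := ⟨a.pred, a.args.map (applyTerm σ)⟩

def Term.vars : Term → Finset ℕ
  | .const _ => ∅
  | .var v => {v}

def Atom.vars (a : Atom) : Finset ℕ := a.args.foldr (fun t s => t.vars ∪ s) ∅

def FactBase.vars (F : FactBase) : Finset ℕ := F.sup Atom.vars

/-- The variables occurring in a (possibly infinite) set of atoms. -/
def setVars (S : Set Atom) : Set ℕ := {v | ∃ a ∈ S, v ∈ a.vars}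

/-- `σ` is a homomorphism from the atom set `S` to the atom set `S'`. -/
def IsHom (σ : Subst) (S S' : Set Atom) : Prop := ∀ a ∈ S, a.subst σ ∈ S'

/-- A retraction is a homomorphism that is the identity on the common variables. -/
def IsRetraction (σ : Subst) (S S' : Set Atom) : Prop :=
  IsHom σ S S' ∧ ∀ v, v ∈ setVars S → v ∈ setVars S' → σ v = Term.var v

/-- An existential rule `B → ∃z.H` with nonempty body and head.  The frontier and
the existential variables are determined by the variables shared between body and
head. -/
structure Rule where
  body : Finset Atom
  head : Finset Atom
  body_nonempty : body.Nonempty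
  head_nonempty : head.Nonempty

instance : DecidableEq Rule := fun R S =>
  decidable_of_iff (R.body = S.body ∧ R.head = S.head) (by
    constructor
    · rintro ⟨h1, h2⟩
      cases R; cases S; simp_all
    · rintro rfl; exact ⟨rfl, rfl⟩)

/-- The frontier of a rule: the variables shared by body and head. -/
def Rule.frontier (R : Rule) : Finset ℕ := FactBase.vars R.body ∩ FactBase.vars R.head

/-- The existential variables of a rule: head variables not occurring in the body. -/
def Rule.exVars (R : Rule) : Finset ℕ := FactBase.vars R.head \ FactBase.vars R.body

/-- A rule is Datalog if it has no existential variable. -/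
def Rule.IsDatalog (R : Rule) : Prop := R.exVars = ∅

/-- A rule has an atomic head if its head is a single atom. -/
def Rule.IsAtomicHead (R : Rule) : Prop := R.head.card = 1

/-- A rule set is a finite set of existential rules. -/
abbrev RuleSet := Finset Rule

instance : Encodable Term :=
  Encodable.ofEquiv (ℕ ⊕ ℕ)
    { toFun := fun t => match t with | .const c => .inl c | .var v => .inr v
      invFun := fun s => match s with | .inl c => .const c | .inr v => .var v
      left_inv := by intro t; cases t <;> rfl
      right_inv := by intro s; cases s <;> rfl }

instance : Encodable Atom :=
  Encodable.ofEquiv (ℕ × List Term)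
    { toFun := fun a => (a.pred, a.args)
      invFun := fun p => ⟨p.1, p.2⟩
      left_inv := fun _ => rfl
      right_inv := fun _ => rfl }

instance : Encodable Rule :=
  Encodable.ofEquiv {p : Finset Atom × Finset Atom // p.1.Nonempty ∧ p.2.Nonempty}
    { toFun := fun R => ⟨(R.body, R.head), R.body_nonempty, R.head_nonempty⟩
      invFun := fun p => ⟨p.1.1, p.1.2, p.2.1, p.2.2⟩
      left_inv := fun _ => rfl
      right_inv := fun _ => rfl }

/-- A trigger `(R, π)`: a rule together with a substitution. -/
structure Trigger where
  rule : Rule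
  map : Subst

/-- The canonical fresh variable `z_t` associated to a trigger `t` and an
existential variable `z`: it is unique for `z` and (the relevant part of) `t`. -/
def Trigger.freshVar (t : Trigger) (z : ℕ) : ℕ :=
  Nat.pair
    (Encodable.encode (t.rule, ((FactBase.vars t.rule.body).sort (· ≤ ·)).map t.map)) z

/-- The extension `π_R` of the substitution of a trigger, mapping each existential
variable `z` to the fresh variable `z_t`. -/
def Trigger.ext (t : Trigger) : Subst := fun v =>
  if v ∈ t.rule.exVars then Term.var (t.freshVar v) else t.map v

/-- The output of a trigger: `out(t) = π_R(H)`. -/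
def Trigger.out (t : Trigger) : Finset Atom := t.rule.head.image (Atom.subst t.ext)

/-- `t` is a trigger on the factbase `F`: its substitution is a homomorphism from
the body of its rule to `F`. -/
def Trigger.IsOn (t : Trigger) (F : FactBase) : Prop := IsHom t.map ↑t.rule.body ↑F

/-- The chase variants: oblivious, semi-oblivious, restricted, equivalent. -/
inductive Variant where
  | O | SO | R | E

/-- Applicability of a trigger on a factbase, for each chase variant. -/
def Applicable : Variant → Trigger → FactBase → Prop
  | .O, t, F => ¬ t.out ⊆ F
  | .SO, t, F => ∀ t' : Trigger, t'.rule = t.rule →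
      (∀ v ∈ t.rule.frontier, t'.map v = t.map v) → ¬ t'.out ⊆ F
  | .R, t, F => ¬ ∃ σ : Subst, IsRetraction σ ↑(F ∪ t.out) ↑F
  | .E, t, F => ¬ ∃ σ : Subst, IsHom σ ↑(F ∪ t.out) ↑F

/-- An atom set `M` satisfies a rule `B → ∃z.H` if every homomorphism from `B`
to `M` extends to a homomorphism mapping `H` into `M`. -/
def SatisfiesRule (M : Set Atom) (R : Rule) : Prop :=
  ∀ σ : Subst, IsHom σ ↑R.body M →
    ∃ σ' : Subst, (∀ v ∈ FactBase.vars R.body, σ' v = σ v) ∧ IsHom σ' ↑R.head M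

/-- A (finite or infinite) derivation from the knowledge base `⟨𝓡, F⟩`:
`len` is the number of triggers (possibly `⊤`), `fb i` is the `i`-th factbase and,
for `i < len`, `tr i` is the trigger producing `fb (i+1)` from `fb i`. -/
structure Derivation (𝓡 : RuleSet) (F : FactBase) where
  len : ℕ∞
  fb : ℕ → FactBase
  tr : ℕ → Trigger
  fb_zero : fb 0 = F
  rule_mem : ∀ i : ℕ, (i : ℕ∞) < len → (tr i).rule ∈ 𝓡
  trig_on : ∀ i : ℕ, (i : ℕ∞) < len → (tr i).IsOn (fb i)
  trig_new : ∀ i : ℕ, (i : ℕ∞) < len → ¬ (tr i).out ⊆ fb i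
  fb_succ : ∀ i : ℕ, (i : ℕ∞) < len → fb (i + 1) = fb i ∪ (tr i).out
  fb_stall : ∀ i : ℕ, ¬ (i : ℕ∞) < len → fb (i + 1) = fb i

namespace Derivation

variable {𝓡 : RuleSet} {F : FactBase}

/-- An `X`-derivation: every applied trigger is `X`-applicable when applied. -/
def IsX (X : Variant) (D : Derivation 𝓡 F) : Prop :=
  ∀ i : ℕ, (i : ℕ∞) < D.len → Applicable X (D.tr i) (D.fb i)

/-- Datalog-first: a non-Datalog rule is only applied when all Datalog rules of
the rule set are satisfied. -/
def DatalogFirst (D : Derivation 𝓡 F) : Prop :=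
  ∀ i : ℕ, (i : ℕ∞) < D.len → ¬ (D.tr i).rule.IsDatalog →
    ∀ R ∈ 𝓡, R.IsDatalog → SatisfiesRule ↑(D.fb i) R

/-- Fairness: every trigger `X`-applicable on some factbase of the derivation is
eventually not `X`-applicable. -/
def Fair (X : Variant) (D : Derivation 𝓡 F) : Prop :=
  ∀ i : ℕ, (i : ℕ∞) ≤ D.len → ∀ t : Trigger, t.rule ∈ 𝓡 → t.IsOn (D.fb i) →
    Applicable X t (D.fb i) →
    ∃ j : ℕ, i < j ∧ (j : ℕ∞) ≤ D.len ∧ ¬ Applicable X t (D.fb j)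

/-- A derivation is finite if its length is not `⊤`. -/
def Finite (D : Derivation 𝓡 F) : Prop := D.len ≠ ⊤

end Derivation

/-- `CT_X^∀` (non-Datalog-first): every fair `X`-derivation from every KB is finite. -/
def CTall (X : Variant) (𝓡 : RuleSet) : Prop :=
  ∀ F : FactBase, ∀ D : Derivation 𝓡 F, D.IsX X → D.Fair X → D.Finite

/-- `CT_X^∃`: some fair `X`-derivation from every KB is finite. -/
def CTex (X : Variant) (𝓡 : RuleSet) : Prop :=
  ∀ F : FactBase, ∃ D : Derivation 𝓡 F, D.IsX X ∧ D.Fair X ∧ D.Finite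

/-- `CT_{df-X}^∀`: every fair Datalog-first `X`-derivation from every KB is finite. -/
def CTallDF (X : Variant) (𝓡 : RuleSet) : Prop :=
  ∀ F : FactBase, ∀ D : Derivation 𝓡 F, D.IsX X → D.DatalogFirst → D.Fair X → D.Finite

/-- `CT_{df-X}^∃`: some fair Datalog-first `X`-derivation from every KB is finite. -/
def CTexDF (X : Variant) (𝓡 : RuleSet) : Prop :=
  ∀ F : FactBase, ∃ D : Derivation 𝓡 F, D.IsX X ∧ D.DatalogFirst ∧ D.Fair X ∧ D.Finite

/-! ### Single-piece decomposition -/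

/-- Adjacency in the piece graph of a rule: two head atoms sharing an existential
variable. -/
def PieceAdj (R : Rule) (a b : Atom) : Prop :=
  a ∈ R.head ∧ b ∈ R.head ∧ (a.vars ∩ b.vars ∩ R.exVars).Nonempty

/-- The piece (connected component of the piece graph) containing a given head atom. -/
def pieceOf (R : Rule) (a : Atom) : Finset Atom :=
  R.head.filter fun b => Relation.ReflTransGen (PieceAdj R) a b

theorem self_mem_pieceOf {R : Rule} {a : Atom} (h : a ∈ R.head) : a ∈ pieceOf R a := by
  rw [pieceOf, Finset.mem_filter]
  exact ⟨h, Relation.ReflTransGen.refl⟩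

/-- The single-piece decomposition of a rule. -/
def Rule.sp (R : Rule) : Finset Rule :=
  R.head.attach.image fun a =>
    ⟨R.body, pieceOf R a.1, R.body_nonempty, ⟨a.1, self_mem_pieceOf a.2⟩⟩

/-- The single-piece decomposition of a rule set. -/
def spSet (𝓡 : RuleSet) : RuleSet := 𝓡.biUnion Rule.sp

/-! ### Atomic decompositions -/

/-- The predicates occurring in a rule set. -/
def RuleSet.predsF (𝓡 : RuleSet) : Finset ℕ :=
  𝓡.sup fun R => (R.body.image Atom.pred) ∪ (R.head.image Atom.pred)

/-- A fresh predicate `X_R`, unique for `R` and not occurring in `𝓡`. -/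
def freshPred (𝓡 : RuleSet) (R : Rule) : ℕ :=
  (RuleSet.predsF 𝓡).sup id + 1 + Encodable.encode R

/-- The atom `X_R(x, z)` over the fresh predicate, whose arguments are the frontier
variables followed by the existential variables of `R`. -/
def xAtom (𝓡 : RuleSet) (R : Rule) : Atom :=
  ⟨freshPred 𝓡 R,
    ((R.frontier.sort (· ≤ ·)).map Term.var) ++ ((R.exVars.sort (· ≤ ·)).map Term.var)⟩

/-- The one-way atomic decomposition of a rule `R = B → ∃z.H` (relative to `𝓡`):
the rule `B → ∃z.X_R(x,z)` together with a rule `X_R(x,z) → P(t)` for each head atom. -/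
def oneAdRule (𝓡 : RuleSet) (R : Rule) : Finset Rule :=
  insert ⟨R.body, {xAtom 𝓡 R}, R.body_nonempty, Finset.singleton_nonempty _⟩
    (R.head.attach.image fun a =>
      ⟨{xAtom 𝓡 R}, {a.1}, Finset.singleton_nonempty _, Finset.singleton_nonempty _⟩)

/-- The one-way atomic decomposition of a rule set. -/
def oneAd (𝓡 : RuleSet) : RuleSet := 𝓡.biUnion (oneAdRule 𝓡)

/-- The two-way atomic decomposition: `2ad(R) = 1ad(R) ∪ {H[x,z] → X_R(x,z)}`. -/
def twoAd (𝓡 : RuleSet) : RuleSet :=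
  oneAd 𝓡 ∪ 𝓡.image fun R =>
    ⟨R.head, {xAtom 𝓡 R}, R.head_nonempty, Finset.singleton_nonempty _⟩

/-! ### Models, entailment, BDDP -/

/-- `M` is a model of the rule set `𝓡`. -/
def IsModelOfRules (𝓡 : RuleSet) (M : Set Atom) : Prop := ∀ R ∈ 𝓡, SatisfiesRule M R

/-- `M` is a model of the knowledge base `⟨𝓡, F⟩`. -/
def IsModelOfKB (𝓡 : RuleSet) (F : FactBase) (M : Set Atom) : Prop :=
  IsModelOfRules 𝓡 M ∧ ∃ σ : Subst, IsHom σ ↑F M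

/-- `M` is a universal model of `⟨𝓡, F⟩`: a model mapping homomorphically into
every model. -/
def IsUniversalModel (𝓡 : RuleSet) (F : FactBase) (M : Set Atom) : Prop :=
  IsModelOfKB 𝓡 F M ∧ ∀ N : Set Atom, IsModelOfKB 𝓡 F N → ∃ σ : Subst, IsHom σ M N

/-- An atom set entails a Boolean conjunctive query `Q` if `Q` maps
homomorphically into it. -/
def EntailsQ (S : Set Atom) (Q : Finset Atom) : Prop := ∃ σ : Subst, IsHom σ ↑Q S

/-- `⟨𝓡, F⟩ ⊨ Q`: every model of the KB entails `Q`. -/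
def KBEntails (𝓡 : RuleSet) (F : FactBase) (Q : Finset Atom) : Prop :=
  ∀ M : Set Atom, IsModelOfKB 𝓡 F M → EntailsQ M Q

/-- `R(F)`: the minimal atom set including `F` and `out(t)` for every trigger `t`
with rule `R` on `F`. -/
def ruleStep (R : Rule) (S : Set Atom) : Set Atom :=
  S ∪ {a | ∃ t : Trigger, t.rule = R ∧ IsHom t.map ↑R.body S ∧ a ∈ t.out}

/-- `𝓡(F) = ⋃_{R ∈ 𝓡} R(F)` (together with `F`). -/
def setStep (𝓡 : RuleSet) (S : Set Atom) : Set Atom := S ∪ ⋃ R ∈ 𝓡, ruleStep R S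

/-- The breadth-first chase `Ch_i(⟨𝓡, F⟩)`. -/
def ch (𝓡 : RuleSet) (F : FactBase) : ℕ → Set Atom
  | 0 => ↑F
  | i + 1 => setStep 𝓡 (ch 𝓡 F i)

/-- The bounded derivation depth property. -/
def BDDP (𝓡 : RuleSet) : Prop :=
  ∀ Q : Finset Atom, ∃ k : ℕ, ∀ F : FactBase, KBEntails 𝓡 F Q ↔ EntailsQ (ch 𝓡 F k) Q

/-! ### Conservative extensions -/

/-- The restriction of an atom set to the atoms over a given set of predicates. -/
def restrictTo (M : Set Atom) (P : Set ℕ) : Set Atom := {a ∈ M | a.pred ∈ P}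

/-- The terms (domain elements) of an atom set. -/
def termsOf (M : Set Atom) : Set Term := {u | ∃ a ∈ M, u ∈ a.args}

/-- `𝓡'` is a conservative extension of `𝓡`. -/
def ConservativeExt (𝓡 𝓡' : RuleSet) : Prop :=
  (↑(RuleSet.predsF 𝓡) : Set ℕ) ⊆ ↑(RuleSet.predsF 𝓡') ∧
  (∀ M : Set Atom, IsModelOfRules 𝓡' M →
    IsModelOfRules 𝓡 (restrictTo M ↑(RuleSet.predsF 𝓡))) ∧
  (∀ M : Set Atom, IsModelOfRules 𝓡 M →
    ∃ M' : Set Atom, M ⊆ M' ∧ IsModelOfRules 𝓡' M' ∧ termsOf M' = termsOf M ∧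
      restrictTo M' ↑(RuleSet.predsF 𝓡) = restrictTo M ↑(RuleSet.predsF 𝓡))

/-- `𝓡'` is a universal-conservative extension of `𝓡`. -/
def UnivConservativeExt (𝓡 𝓡' : RuleSet) : Prop :=
  (↑(RuleSet.predsF 𝓡) : Set ℕ) ⊆ ↑(RuleSet.predsF 𝓡') ∧
  ∀ F : FactBase, (∀ a ∈ F, a.pred ∈ RuleSet.predsF 𝓡) →
    (∀ M : Set Atom, IsUniversalModel 𝓡' F M →
      IsUniversalModel 𝓡 F (restrictTo M ↑(RuleSet.predsF 𝓡))) ∧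
    (∀ M : Set Atom, IsUniversalModel 𝓡 F M →
      ∃ M' : Set Atom, M ⊆ M' ∧ IsUniversalModel 𝓡' F M' ∧ termsOf M' = termsOf M ∧
        restrictTo M' ↑(RuleSet.predsF 𝓡) = restrictTo M ↑(RuleSet.predsF 𝓡))

/-! ### Variables and substitutions -/

theorem Atom.mem_vars {a : Atom} {v : ℕ} : v ∈ a.vars ↔ Term.var v ∈ a.args := by
  obtain ⟨p, l⟩ := a
  simp only [Atom.vars]
  induction l with
  | nil => simp
  | cons u l ih =>
    rw [List.foldr_cons, Finset.mem_union, ih, List.mem_cons]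
    cases u <;> simp [Term.vars]

theorem FactBase.mem_vars {F : FactBase} {v : ℕ} : v ∈ FactBase.vars F ↔ ∃ a ∈ F, v ∈ a.vars := by
  simp [FactBase.vars, Finset.mem_sup]

theorem FactBase.vars_mono {F G : FactBase} (h : F ⊆ G) :
    FactBase.vars F ⊆ FactBase.vars G := fun v hv => by
  obtain ⟨a, ha, hv⟩ := FactBase.mem_vars.1 hv
  exact FactBase.mem_vars.2 ⟨a, h ha, hv⟩

theorem Atom.subst_congr {a : Atom} {σ τ : Subst} (h : ∀ v ∈ a.vars, σ v = τ v) :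
    a.subst σ = a.subst τ := by
  simp only [Atom.subst, Atom.mk.injEq, true_and]
  refine List.map_congr_left fun u hu => ?_
  cases u with
  | const c => rfl
  | var v => exact h v (Atom.mem_vars.2 hu)

theorem Atom.subst_subst (a : Atom) (σ τ : Subst) :
    (a.subst σ).subst τ = a.subst (fun v => applyTerm τ (σ v)) := by
  simp only [Atom.subst, List.map_map, Atom.mk.injEq, true_and]
  refine List.map_congr_left fun u _ => ?_
  cases u <;> rfl

theorem Atom.mem_vars_subst {a : Atom} {σ : Subst} {v : ℕ} :
    v ∈ (a.subst σ).vars ↔ ∃ u ∈ a.vars, σ u = Term.var v := by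
  simp only [Atom.mem_vars, Atom.subst, List.mem_map]
  constructor
  · rintro ⟨u, hu, h⟩
    cases u with
    | const c => simp [applyTerm] at h
    | var u => exact ⟨u, hu, h⟩
  · rintro ⟨u, hu, h⟩
    exact ⟨_, hu, h⟩

/-- The substitution varSubst variables along a map. -/
def varSubst (g : ℕ → ℕ) : Subst := fun v => Term.var (g v)

theorem applyTerm_varSubst_inj {g : ℕ → ℕ} {S : Set ℕ} (hg : S.InjOn g) {u w : Term}
    (hu : ∀ v, u = Term.var v → v ∈ S) (hw : ∀ v, w = Term.var v → v ∈ S)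
    (h : applyTerm (varSubst g) u = applyTerm (varSubst g) w) : u = w := by
  cases u <;> cases w <;> simp_all [applyTerm, varSubst]
  exact hg hu hw h

theorem applyTerm_varSubst_congr {f g : ℕ → ℕ} {u : Term}
    (h : ∀ v, u = Term.var v → f v = g v) :
    applyTerm (varSubst f) u = applyTerm (varSubst g) u := by
  cases u <;> simp_all [applyTerm, varSubst]

theorem list_map_applyTerm_varSubst_inj {g : ℕ → ℕ} {S : Set ℕ} (hg : S.InjOn g) :
    ∀ {l l' : List Term}, (∀ v, Term.var v ∈ l → v ∈ S) → (∀ v, Term.var v ∈ l' → v ∈ S) →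
      l.map (applyTerm (varSubst g)) = l'.map (applyTerm (varSubst g)) → l = l'
  | [], [], _, _, _ => rfl
  | [], _ :: _, _, _, h => by simp at h
  | _ :: _, [], _, _, h => by simp at h
  | u :: l, w :: l', hl, hl', h => by
    simp only [List.map_cons, List.cons.injEq] at h
    rw [applyTerm_varSubst_inj hg (fun v hv => hl v (by simp [hv]))
        (fun v hv => hl' v (by simp [hv])) h.1,
      list_map_applyTerm_varSubst_inj hg (fun v hv => hl v (by simp [hv]))
        (fun v hv => hl' v (by simp [hv])) h.2]

theorem Atom.subst_varSubst_injOn {g : ℕ → ℕ} {F : FactBase}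
    (hg : Set.InjOn g ↑(FactBase.vars F)) :
    Set.InjOn (Atom.subst (varSubst g)) (↑F : Set Atom) := by
  intro a ha b hb h
  simp only [Atom.subst, Atom.mk.injEq] at h
  have hvars : ∀ c ∈ F, ∀ v, Term.var v ∈ c.args → v ∈ (↑(FactBase.vars F) : Set ℕ) :=
    fun c hc v hv => Finset.mem_coe.2 (FactBase.mem_vars.2 ⟨c, hc, Atom.mem_vars.2 hv⟩)
  have := list_map_applyTerm_varSubst_inj hg (hvars a ha) (hvars b hb) h.2
  cases a; cases b; simp_all

/-! ### Triggers -/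

theorem IsHom.mem_vars {σ : Subst} {B F : FactBase} (h : IsHom σ ↑B ↑F) {x v : ℕ}
    (hx : x ∈ FactBase.vars B) (hv : σ x = Term.var v) : v ∈ FactBase.vars F := by
  obtain ⟨a, ha, hxa⟩ := FactBase.mem_vars.1 hx
  exact FactBase.mem_vars.2 ⟨_, h a ha, Atom.mem_vars_subst.2 ⟨x, hxa, hv⟩⟩

theorem Trigger.IsOn.mono {t : Trigger} {F G : FactBase} (h : t.IsOn F) (hFG : F ⊆ G) :
    t.IsOn G := fun a ha => hFG (h a ha)

theorem Rule.mem_frontier {R : Rule} {v : ℕ} :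
    v ∈ R.frontier ↔ v ∈ FactBase.vars R.body ∧ v ∈ FactBase.vars R.head := by
  simp [Rule.frontier]

theorem Rule.mem_exVars {R : Rule} {v : ℕ} :
    v ∈ R.exVars ↔ v ∈ FactBase.vars R.head ∧ v ∉ FactBase.vars R.body := by
  simp [Rule.exVars]

/-- A natural number identifying a trigger up to the values of its substitution outside
the body variables. -/
def Trigger.code (t : Trigger) : ℕ :=
  Encodable.encode (t.rule, ((FactBase.vars t.rule.body).sort (· ≤ ·)).map t.map)

theorem Trigger.freshVar_eq (t : Trigger) (z : ℕ) : t.freshVar z = Nat.pair t.code z := rfl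

theorem Trigger.freshVar_inj {t t' : Trigger} {z z' : ℕ} :
    t.freshVar z = t'.freshVar z' ↔ t.code = t'.code ∧ z = z' := by
  simp [Trigger.freshVar_eq, Nat.pair_eq_pair]

theorem Trigger.code_eq_iff {t t' : Trigger} : t.code = t'.code ↔
    t.rule = t'.rule ∧ ∀ v ∈ FactBase.vars t.rule.body, t.map v = t'.map v := by
  obtain ⟨R, f⟩ := t
  obtain ⟨R', f'⟩ := t'
  simp only [Trigger.code, Encodable.encode_inj, Prod.mk.injEq]
  constructor
  · rintro ⟨rfl, h⟩
    refine ⟨rfl, fun v hv => ?_⟩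
    exact List.map_inj_left.1 h v ((Finset.mem_sort _).2 hv)
  · rintro ⟨rfl, h⟩
    exact ⟨rfl, List.map_congr_left fun v hv => h v ((Finset.mem_sort _).1 hv)⟩

theorem Trigger.out_eq_of_code_eq {t t' : Trigger} (h : t.code = t'.code) : t.out = t'.out := by
  have hfresh : ∀ z, t.freshVar z = t'.freshVar z := fun z => Trigger.freshVar_inj.2 ⟨h, rfl⟩
  obtain ⟨hr, hm⟩ := Trigger.code_eq_iff.1 h
  simp only [Trigger.out, ← hr]
  refine Finset.image_congr fun a ha => Atom.subst_congr fun v hv => ?_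
  simp only [Trigger.ext, ← hr, hfresh]
  split_ifs with hz
  · rfl
  · refine hm v ?_
    by_contra hb
    exact hz (Rule.mem_exVars.2 ⟨FactBase.mem_vars.2 ⟨a, ha, hv⟩, hb⟩)

/-- No fresh variable is the pairing of this number with some number, since it encodes a
pair of empty atom sets instead of a rule. -/
def nonCode : ℕ := Encodable.encode (((∅, ∅) : Finset Atom × Finset Atom), ([] : List Term))

theorem Trigger.code_ne_nonCode (t : Trigger) : t.code ≠ nonCode := by
  intro h
  simp only [Trigger.code, nonCode, Encodable.encode_prod_val, Nat.pair_eq_pair] at h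
  have h1 : Encodable.encode (t.rule.body, t.rule.head)
      = Encodable.encode ((∅, ∅) : Finset Atom × Finset Atom) := by
    rw [Encodable.encode_prod_val, Encodable.encode_prod_val]
    exact h.1
  have h2 := Encodable.encode_injective h1
  exact t.rule.body_nonempty.ne_empty (Prod.mk.inj h2).1

/-- The variables of a rule that determine the applicability of its triggers: all body
variables in the oblivious case, the frontier otherwise. -/
def relevantVars : Variant → Rule → Finset ℕ
  | .O, R => FactBase.vars R.body
  | _, R => R.frontier

theorem frontier_subset_relevantVars (X : Variant) (R : Rule) :
    R.frontier ⊆ relevantVars X R := by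
  cases X <;> simp [relevantVars, Rule.frontier]

theorem relevantVars_subset_body (X : Variant) (R : Rule) :
    relevantVars X R ⊆ FactBase.vars R.body := by
  cases X <;> simp [relevantVars, Rule.frontier]

theorem applicable_iff {X : Variant} (hX : X = Variant.O ∨ X = Variant.SO) {t : Trigger}
    {F : FactBase} : Applicable X t F ↔ ∀ t' : Trigger, t'.rule = t.rule →
      (∀ v ∈ relevantVars X t.rule, t'.map v = t.map v) → ¬ t'.out ⊆ F := by
  rcases hX with rfl | rfl
  · refine ⟨fun h t' hr hm => ?_, fun h => h t rfl fun _ _ => rfl⟩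
    rw [Trigger.out_eq_of_code_eq (Trigger.code_eq_iff.2 ⟨hr, fun v hv => hm v (hr ▸ hv)⟩)]
    exact h
  · exact Iff.rfl

theorem Applicable.not_out_subset {X : Variant} (hX : X = Variant.O ∨ X = Variant.SO)
    {t : Trigger} {F : FactBase} (h : Applicable X t F) : ¬ t.out ⊆ F :=
  (applicable_iff hX).1 h t rfl fun _ _ => rfl

/-! ### Saturated factbases -/

/-- For a terminating rule set, every factbase extends to a finite one on which no trigger is
applicable. -/
theorem CTall.exists_saturated {X : Variant} (hX : X = Variant.O ∨ X = Variant.SO)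
    {𝓡 : RuleSet} (h : CTall X 𝓡) (F : FactBase) :
    ∃ G : FactBase, F ⊆ G ∧
      ∀ t : Trigger, t.rule ∈ 𝓡 → t.IsOn G → ¬ Applicable X t G := by
  by_contra! hne
  have hmin : ∀ G : {G : FactBase // F ⊆ G}, ∃ t : Trigger,
      (t.rule ∈ 𝓡 ∧ t.IsOn G.1 ∧ Applicable X t G.1) ∧
      ∀ t' : Trigger, t'.rule ∈ 𝓡 ∧ t'.IsOn G.1 ∧ Applicable X t' G.1 → t.code ≤ t'.code := by
    intro G
    obtain ⟨t, ht⟩ := hne G.1 G.2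
    obtain ⟨t₀, ht₀, hle⟩ := WellFounded.has_min (measure Trigger.code).wf
      {t : Trigger | t.rule ∈ 𝓡 ∧ t.IsOn G.1 ∧ Applicable X t G.1} ⟨t, ht⟩
    exact ⟨t₀, ht₀, fun t' ht' => not_lt.1 (hle t' ht')⟩
  choose f hf hfmin using hmin
  let s : ℕ → {G : FactBase // F ⊆ G} := fun n =>
    Nat.rec ⟨F, Finset.Subset.refl F⟩
      (fun _ G => ⟨G.1 ∪ (f G).out, G.2.trans Finset.subset_union_left⟩) n
  have hs : ∀ n, (s (n + 1)).1 = (s n).1 ∪ (f (s n)).out := fun _ => rfl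
  have hmono : Monotone fun n => (s n).1 :=
    monotone_nat_of_le_succ fun n => by
      rw [hs]
      exact Finset.subset_union_left
  have hnew : ∀ j k, j < k → (f (s j)).code ≠ (f (s k)).code := fun j k hjk hc =>
    (hf (s k)).2.2.not_out_subset hX <| by
      rw [← Trigger.out_eq_of_code_eq hc]
      exact (Finset.subset_union_right.trans (hs j).ge).trans (hmono hjk)
  let D : Derivation 𝓡 F :=
    { len := ⊤
      fb := fun n => (s n).1
      tr := fun n => f (s n)
      fb_zero := rfl
      rule_mem := fun i _ => (hf (s i)).1
      trig_on := fun i _ => (hf (s i)).2.1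
      trig_new := fun i _ => (hf (s i)).2.2.not_out_subset hX
      fb_succ := fun i _ => hs i
      fb_stall := fun i hi => absurd (ENat.natCast_lt_top i) hi }
  refine h F D (fun i _ => (hf (s i)).2.2) ?_ rfl
  intro i _ t htr hon happ
  by_contra! hall
  have hle : ∀ k, (f (s (i + k))).code ≤ t.code := fun k => by
    refine hfmin _ t ⟨htr, hon.mono (hmono (Nat.le_add_right i k)), ?_⟩
    rcases Nat.eq_zero_or_pos k with rfl | hk
    · exact happ
    · exact hall (i + k) (by lia) le_top
  have hinj : Function.Injective fun k => (f (s (i + k))).code := fun j k hjk => by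
    rcases lt_trichotomy j k with hlt | heq | hlt
    · exact absurd hjk (hnew _ _ (by lia))
    · exact heq
    · exact absurd hjk.symm (hnew _ _ (by lia))
  exact Set.infinite_range_of_injective hinj
    ((Set.finite_Iic t.code).subset (Set.range_subset_iff.2 hle))

/-! ### Pieces -/

theorem PieceAdj.symm {R : Rule} {a b : Atom} (h : PieceAdj R a b) : PieceAdj R b a := by
  refine ⟨h.2.1, h.1, ?_⟩
  rw [Finset.inter_comm b.vars]
  exact h.2.2

theorem pieceOf_eq_of_reachable {R : Rule} {a b : Atom}
    (h : Relation.ReflTransGen (PieceAdj R) a b) : pieceOf R a = pieceOf R b := by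
  have : Std.Symm (PieceAdj R) := ⟨fun _ _ => PieceAdj.symm⟩
  ext c
  simp only [pieceOf, Finset.mem_filter, and_congr_right_iff]
  exact fun _ => ⟨(symm h).trans, h.trans⟩

theorem Rule.mem_sp {R S : Rule} :
    S ∈ R.sp ↔ S.body = R.body ∧ ∃ a ∈ R.head, S.head = pieceOf R a := by
  simp only [Rule.sp, Finset.mem_image, Finset.mem_attach, true_and, Subtype.exists]
  constructor
  · rintro ⟨a, ha, rfl⟩
    exact ⟨rfl, a, ha, rfl⟩
  · rintro ⟨hb, a, ha, hh⟩
    refine ⟨a, ha, ?_⟩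
    cases S
    simp_all

theorem Rule.head_subset_of_mem_sp {R S : Rule} (h : S ∈ R.sp) : S.head ⊆ R.head := by
  obtain ⟨_, a, _, hh⟩ := Rule.mem_sp.1 h
  rw [hh]
  exact Finset.filter_subset _ _

theorem Rule.exVars_subset_of_mem_sp {R S : Rule} (h : S ∈ R.sp) : S.exVars ⊆ R.exVars := by
  intro v hv
  rw [Rule.mem_exVars, (Rule.mem_sp.1 h).1] at hv
  exact Rule.mem_exVars.2 ⟨FactBase.vars_mono (Rule.head_subset_of_mem_sp h) hv.1, hv.2⟩

theorem relevantVars_subset_of_mem_sp (X : Variant) {R S : Rule} (h : S ∈ R.sp) :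
    relevantVars X S ⊆ relevantVars X R := by
  have hb := (Rule.mem_sp.1 h).1
  have hf : S.frontier ⊆ R.frontier := fun v hv => by
    rw [Rule.mem_frontier, hb] at hv
    exact Rule.mem_frontier.2
      ⟨hv.1, FactBase.vars_mono (Rule.head_subset_of_mem_sp h) hv.2⟩
  cases X <;> simp [relevantVars, hb, hf]

/-- Distinct pieces of a rule have no existential variable in common. -/
theorem Rule.eq_of_mem_sp_of_mem_exVars {R S T : Rule} (hS : S ∈ R.sp) (hT : T ∈ R.sp) {z : ℕ}
    (hzS : z ∈ S.exVars) (hzT : z ∈ T.exVars) : S = T := by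
  have hzR := Rule.exVars_subset_of_mem_sp hS hzS
  obtain ⟨hSb, a, ha, hSh⟩ := Rule.mem_sp.1 hS
  obtain ⟨hTb, b, hb, hTh⟩ := Rule.mem_sp.1 hT
  obtain ⟨c, hc, hzc⟩ := FactBase.mem_vars.1 (Rule.mem_exVars.1 hzS).1
  obtain ⟨d, hd, hzd⟩ := FactBase.mem_vars.1 (Rule.mem_exVars.1 hzT).1
  rw [hSh, pieceOf, Finset.mem_filter] at hc
  rw [hTh, pieceOf, Finset.mem_filter] at hd
  have hcd : PieceAdj R c d := ⟨hc.1, hd.1, z, by simp [hzc, hzd, hzR]⟩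
  have hhead : S.head = T.head := by
    rw [hSh, hTh, pieceOf_eq_of_reachable hc.2, pieceOf_eq_of_reachable hd.2,
      pieceOf_eq_of_reachable (Relation.ReflTransGen.single hcd)]
  cases S; cases T
  simp_all

/-! ### Infinite derivations -/

namespace Derivation

variable {𝓡 : RuleSet} {F : FactBase} (D : Derivation 𝓡 F)

theorem fb_mono : Monotone D.fb := monotone_nat_of_le_succ fun n => by
  by_cases h : (n : ℕ∞) < D.len
  · rw [D.fb_succ n h]
    exact Finset.subset_union_left
  · exact (D.fb_stall n h).ge

theorem out_subset {i j : ℕ} (hi : (i : ℕ∞) < D.len) (hij : i < j) : (D.tr i).out ⊆ D.fb j :=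
  (Finset.subset_union_right.trans (D.fb_succ i hi).ge).trans (D.fb_mono hij)

theorem code_ne {i j : ℕ} (hlen : D.len = ⊤) (hij : i < j) :
    (D.tr i).code ≠ (D.tr j).code := fun hc =>
  D.trig_new j (hlen ▸ ENat.natCast_lt_top j) <| by
    rw [← Trigger.out_eq_of_code_eq hc]
    exact D.out_subset (hlen ▸ ENat.natCast_lt_top i) hij

theorem code_injective (hlen : D.len = ⊤) : Function.Injective fun i => (D.tr i).code := by
  intro i j hij
  rcases lt_trichotomy i j with h | h | h
  · exact absurd hij (D.code_ne hlen h)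
  · exact h
  · exact absurd hij.symm (D.code_ne hlen h)

theorem le_card_fb (hlen : D.len = ⊤) (n : ℕ) : n ≤ (D.fb n).card := by
  induction n with
  | zero => simp
  | succ n ih =>
    have hn : (n : ℕ∞) < D.len := hlen ▸ ENat.natCast_lt_top n
    refine Nat.succ_le_of_lt (ih.trans_lt (Finset.card_lt_card ?_))
    refine (Finset.ssubset_iff_subset_ne).2 ⟨D.fb_mono n.le_succ, fun he => ?_⟩
    exact D.trig_new n hn (he ▸ D.out_subset hn n.lt_succ_self)

theorem mem_vars_fb_succ {i : ℕ} (hi : (i : ℕ∞) < D.len) {v : ℕ}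
    (hv : v ∈ FactBase.vars (D.fb (i + 1))) :
    v ∈ FactBase.vars (D.fb i) ∨ ∃ z ∈ (D.tr i).rule.exVars, v = (D.tr i).freshVar z := by
  rw [D.fb_succ i hi] at hv
  obtain ⟨a, ha, hva⟩ := FactBase.mem_vars.1 hv
  rcases Finset.mem_union.1 ha with ha | ha
  · exact Or.inl (FactBase.mem_vars.2 ⟨a, ha, hva⟩)
  · obtain ⟨b, hb, rfl⟩ := Finset.mem_image.1 ha
    obtain ⟨u, hu, huv⟩ := Atom.mem_vars_subst.1 hva
    rw [Trigger.ext] at huv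
    split_ifs at huv with hz
    · exact Or.inr ⟨u, hz, (Term.var.inj huv).symm⟩
    · refine Or.inl ((D.trig_on i hi).mem_vars ?_ huv)
      by_contra hub
      exact hz (Rule.mem_exVars.2 ⟨FactBase.mem_vars.2 ⟨b, hb, hu⟩, hub⟩)

theorem mem_vars_fb (hlen : D.len = ⊤) {i v : ℕ} (hv : v ∈ FactBase.vars (D.fb i)) :
    v ∈ FactBase.vars F ∨ ∃ j < i, ∃ z, v = (D.tr j).freshVar z := by
  induction i with
  | zero => exact Or.inl (D.fb_zero ▸ hv)
  | succ i ih =>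
    rcases D.mem_vars_fb_succ (hlen ▸ ENat.natCast_lt_top i) hv with h | ⟨z, _, h⟩
    · rcases ih h with h | ⟨j, hj, z, h⟩
      · exact Or.inl h
      · exact Or.inr ⟨j, by lia, z, h⟩
    · exact Or.inr ⟨i, by lia, z, h⟩

/-- From some point on, the existential variables of the triggers of an infinite derivation
are really fresh, even if the initial factbase uses some of the canonical fresh variables. -/
theorem exists_fresh_from (hlen : D.len = ⊤) :
    ∃ m, ∀ i ≥ m, ∀ z, (D.tr i).freshVar z ∉ FactBase.vars (D.fb i) := by
  let S : Set ℕ := {i | ∃ z, (D.tr i).freshVar z ∈ FactBase.vars F}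
  have hfin : S.Finite := by
    refine Set.Finite.of_finite_image (f := fun i => (D.tr i).code) ?_
      (D.code_injective hlen).injOn
    refine ((FactBase.vars F).image fun v => v.unpair.1).finite_toSet.subset ?_
    rintro _ ⟨i, ⟨z, hz⟩, rfl⟩
    exact Finset.mem_coe.2 (Finset.mem_image.2 ⟨_, hz, by simp [Trigger.freshVar_eq]⟩)
  obtain ⟨b, hb⟩ := hfin.bddAbove
  refine ⟨b + 1, fun i hi z hz => ?_⟩
  rcases D.mem_vars_fb hlen hz with h | ⟨j, hj, z', h⟩
  · have : i ≤ b := hb ⟨z, h⟩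
    lia
  · exact D.code_ne hlen hj (Trigger.freshVar_inj.1 h).1.symm

end Derivation

/-! ### Embedding a chase of the decomposition into a saturated factbase -/

/-- `g` renames the variables of the `i`-th factbase injectively so as to embed it into `G`,
sending the fresh variables introduced from step `m` on to fresh variables of triggers of the
undecomposed rules given by `orig`, and every other variable to one that is never fresh. -/
structure IsEmbedding {𝓡 : RuleSet} {F : FactBase} (X : Variant) (D : Derivation 𝓡 F)
    (orig : Rule → Rule) (G : FactBase) (i : ℕ) (g : ℕ → ℕ) : Prop where
  hom : IsHom (varSubst g) ↑(D.fb i) ↑G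
  injOn : Set.InjOn g ↑(FactBase.vars (D.fb i))
  origin : ∀ v ∈ FactBase.vars (D.fb i), (∃ u, g v = Nat.pair nonCode u) ∨
    ∃ j < i, ∃ z ∈ (D.tr j).rule.exVars, ∃ t : Trigger, t.rule = orig (D.tr j).rule ∧
      v = (D.tr j).freshVar z ∧ g v = t.freshVar z ∧
      ∀ x ∈ relevantVars X t.rule, t.map x = applyTerm (varSubst g) ((D.tr j).map x)

theorem isEmbedding_pair_nonCode {𝓡 : RuleSet} {F : FactBase} (X : Variant)
    (D : Derivation 𝓡 F) (orig : Rule → Rule) {G : FactBase} {i : ℕ}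
    (hG : (D.fb i).image (Atom.subst (varSubst (Nat.pair nonCode))) ⊆ G) :
    IsEmbedding X D orig G i (Nat.pair nonCode) where
  hom := fun _ ha => hG (Finset.mem_image_of_mem _ ha)
  injOn := fun _ _ _ _ h => (Nat.pair_eq_pair.1 h).2
  origin := fun v _ => Or.inl ⟨v, rfl⟩

theorem IsEmbedding.exists_succ {X : Variant} (hX : X = Variant.O ∨ X = Variant.SO)
    {𝓡 𝓢 : RuleSet} {F : FactBase} {D : Derivation 𝓢 F} (hD : D.IsX X) (hlen : D.len = ⊤)
    {orig : Rule → Rule} (horig : ∀ S ∈ 𝓢, orig S ∈ 𝓡 ∧ S ∈ (orig S).sp) {G : FactBase}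
    (hG : ∀ t : Trigger, t.rule ∈ 𝓡 → t.IsOn G → ¬ Applicable X t G) {i : ℕ}
    (hfresh : ∀ z, (D.tr i).freshVar z ∉ FactBase.vars (D.fb i)) {g : ℕ → ℕ}
    (hg : IsEmbedding X D orig G i g) : ∃ g', IsEmbedding X D orig G (i + 1) g' := by
  have hlt : ∀ j : ℕ, (j : ℕ∞) < D.len := fun j => hlen ▸ ENat.natCast_lt_top j
  set t := D.tr i with ht
  have hon : t.IsOn (D.fb i) := D.trig_on i (hlt i)
  obtain ⟨hR, hsp⟩ := horig t.rule (D.rule_mem i (hlt i))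
  have hbody : t.rule.body = (orig t.rule).body := (Rule.mem_sp.1 hsp).1
  have himage : (⟨orig t.rule, fun v => applyTerm (varSubst g) (t.map v)⟩ : Trigger).IsOn G := by
    intro a ha
    rw [← Atom.subst_subst]
    exact hg.hom _ (hon a (hbody ▸ ha))
  have hnot := hG _ hR himage
  rw [applicable_iff hX] at hnot
  push Not at hnot
  obtain ⟨T, hTr, hTm, hTout⟩ := hnot
  dsimp only at hTr hTm
  -- the values of an earlier trigger involve only variables of the current factbase
  have hmem : ∀ j ≤ i, ∀ x ∈ FactBase.vars (D.tr j).rule.body, ∀ v,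
      (D.tr j).map x = Term.var v → v ∈ FactBase.vars (D.fb i) := fun j hj x hx v hv =>
    FactBase.vars_mono (D.fb_mono hj) ((D.trig_on j (hlt j)).mem_vars hx hv)
  let g' : ℕ → ℕ := fun v =>
    if ∃ z ∈ t.rule.exVars, v = t.freshVar z then T.freshVar v.unpair.2 else g v
  have hg'old : ∀ v ∈ FactBase.vars (D.fb i), g' v = g v := fun v hv => by
    refine if_neg ?_
    rintro ⟨z, _, rfl⟩
    exact hfresh z hv
  have hg'new : ∀ z ∈ t.rule.exVars, g' (t.freshVar z) = T.freshVar z := fun z hz => by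
    simp only [g']
    rw [if_pos ⟨z, hz, rfl⟩, Trigger.freshVar_eq t, Nat.unpair_pair]
  have hbody_orig : ∀ j, FactBase.vars (orig (D.tr j).rule).body
      = FactBase.vars (D.tr j).rule.body := fun j => by
    rw [(Rule.mem_sp.1 (horig _ (D.rule_mem j (hlt j))).2).1]
  have hmap : ∀ j ≤ i, ∀ x ∈ FactBase.vars (D.tr j).rule.body,
      applyTerm (varSubst g') ((D.tr j).map x) = applyTerm (varSubst g) ((D.tr j).map x) :=
    fun j hj x hx => applyTerm_varSubst_congr fun v hv => hg'old v (hmem j hj x hx v hv)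
  have hsep : ∀ v ∈ FactBase.vars (D.fb i), ∀ z ∈ t.rule.exVars, g v ≠ T.freshVar z := by
    intro v hv z hz heq
    rcases hg.origin v hv with ⟨u, hu⟩ | ⟨j, hj, z', hz', T', hT'r, -, hgv, hT'm⟩
    · rw [hu, Trigger.freshVar_eq] at heq
      exact T.code_ne_nonCode (Nat.pair_eq_pair.1 heq).1.symm
    · rw [hgv] at heq
      obtain ⟨hc, rfl⟩ := Trigger.freshVar_inj.1 heq
      obtain ⟨hr, hm⟩ := Trigger.code_eq_iff.1 hc
      have horig_eq : orig (D.tr j).rule = orig t.rule := by rw [← hT'r, hr, hTr]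
      have hrule : (D.tr j).rule = t.rule :=
        Rule.eq_of_mem_sp_of_mem_exVars
          (horig_eq ▸ (horig _ (D.rule_mem j (hlt j))).2) hsp hz' hz
      refine (applicable_iff hX).1 (hD i (hlt i)) (D.tr j) hrule (fun x hx => ?_)
        (D.out_subset (hlt j) hj)
      have hxR : x ∈ relevantVars X (orig t.rule) := relevantVars_subset_of_mem_sp X hsp hx
      have hxb : x ∈ FactBase.vars t.rule.body := relevantVars_subset_body X _ hx
      refine applyTerm_varSubst_inj hg.injOn
        (fun v hv => hmem j hj.le x (hrule ▸ hxb) v hv)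
        (fun v hv => hmem i le_rfl x hxb v hv) ?_
      rw [← hT'm x (by rw [hr, hTr]; exact hxR), ← ht, ← hTm x hxR]
      refine hm x ?_
      rw [hr, hTr, ← hbody]
      exact hxb
  refine ⟨g', ?_, ?_, ?_⟩
  · intro a ha
    rw [D.fb_succ i (hlt i), Finset.mem_coe] at ha
    rcases Finset.mem_union.1 ha with ha | ha
    · rw [Atom.subst_congr (τ := varSubst g) fun v hv => by
        simp only [varSubst, hg'old v (FactBase.mem_vars.2 ⟨a, ha, hv⟩)]]
      exact hg.hom a ha
    · obtain ⟨b, hb, rfl⟩ := Finset.mem_image.1 ha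
      have hbT : b ∈ T.rule.head := hTr ▸ Rule.head_subset_of_mem_sp hsp hb
      rw [Atom.subst_subst, Atom.subst_congr (τ := T.ext)]
      · exact hTout (Finset.mem_image_of_mem _ hbT)
      · intro x hx
        have hxh : x ∈ FactBase.vars t.rule.head := FactBase.mem_vars.2 ⟨b, hb, hx⟩
        by_cases hz : x ∈ t.rule.exVars
        · rw [← ht, Trigger.ext, if_pos hz, Trigger.ext,
            if_pos (hTr ▸ Rule.exVars_subset_of_mem_sp hsp hz)]
          simp only [applyTerm, varSubst, hg'new x hz]
        · have hxb : x ∈ FactBase.vars t.rule.body := by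
            by_contra hxb
            exact hz (Rule.mem_exVars.2 ⟨hxh, hxb⟩)
          have hxT : x ∉ T.rule.exVars := by
            rw [hTr, Rule.mem_exVars, ← hbody]
            exact fun h => h.2 hxb
          rw [← ht, Trigger.ext, if_neg hz, Trigger.ext, if_neg hxT, hmap i le_rfl x hxb]
          exact (hTm x (relevantVars_subset_of_mem_sp X hsp
            (frontier_subset_relevantVars X _ (Rule.mem_frontier.2 ⟨hxb, hxh⟩)))).symm
  · intro v hv w hw hvw
    rcases D.mem_vars_fb_succ (hlt i) hv with hv | ⟨z, hz, rfl⟩ <;>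
      rcases D.mem_vars_fb_succ (hlt i) hw with hw | ⟨z', hz', rfl⟩
    · rw [hg'old v hv, hg'old w hw] at hvw
      exact hg.injOn hv hw hvw
    · rw [hg'old v hv, hg'new z' hz'] at hvw
      exact absurd hvw (hsep v hv z' hz')
    · rw [hg'old w hw, hg'new z hz] at hvw
      exact absurd hvw.symm (hsep w hw z hz)
    · rw [hg'new z hz, hg'new z' hz'] at hvw
      rw [(Trigger.freshVar_inj.1 hvw).2]
  · intro v hv
    rcases D.mem_vars_fb_succ (hlt i) hv with hv | ⟨z, hz, rfl⟩
    · rw [hg'old v hv]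
      refine (hg.origin v hv).imp_right ?_
      rintro ⟨j, hj, z, hz, T', hT'r, hv', hgv, hT'm⟩
      refine ⟨j, by lia, z, hz, T', hT'r, hv', hgv, fun x hx => ?_⟩
      rw [hT'm x hx, hmap j hj.le x]
      rw [← hbody_orig j, ← hT'r]
      exact relevantVars_subset_body X _ hx
    · refine Or.inr ⟨i, by lia, z, hz, T, hTr, rfl, hg'new z hz, fun x hx => ?_⟩
      rw [hTr] at hx
      rw [hTm x hx, hmap i le_rfl x]
      rw [← hbody_orig i]
      exact relevantVars_subset_body X _ hx

/-- The single-piece decomposition preserves termination of the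
oblivious and semi-oblivious chase. -/
theorem statement3 (X : Variant) (hX : X = Variant.O ∨ X = Variant.SO)
    (𝓡 : RuleSet) (h : CTall X 𝓡) : CTall X (spSet 𝓡) := by
  intro F D hD _ hlen
  have horig : ∀ S : Rule, ∃ R : Rule, S ∈ spSet 𝓡 → R ∈ 𝓡 ∧ S ∈ R.sp := fun S => by
    by_cases hS : S ∈ spSet 𝓡
    · obtain ⟨R, hR, hSR⟩ := Finset.mem_biUnion.1 hS
      exact ⟨R, fun _ => ⟨hR, hSR⟩⟩
    · exact ⟨S, fun h => absurd h hS⟩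
  choose orig horig using horig
  obtain ⟨m, hm⟩ := D.exists_fresh_from hlen
  obtain ⟨G, hFG, hG⟩ := h.exists_saturated hX
    ((D.fb m).image (Atom.subst (varSubst (Nat.pair nonCode))))
  have hemb : ∀ k, ∃ g, IsEmbedding X D orig G (m + k) g := fun k => by
    induction k with
    | zero => exact ⟨_, isEmbedding_pair_nonCode X D orig hFG⟩
    | succ k ih =>
      obtain ⟨g, hg⟩ := ih
      exact hg.exists_succ hX hD hlen horig hG (hm _ (Nat.le_add_right m k))
  obtain ⟨g, hg⟩ := hemb (G.card + 1)
  have hcard : (D.fb (m + (G.card + 1))).card ≤ G.card :=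
    Finset.card_le_card_of_injOn _ hg.hom (Atom.subst_varSubst_injOn hg.injOn)
  have := D.le_card_fb hlen (m + (G.card + 1))
  lia

end
end ExRules
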